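/- Suppose U(x) = (x−1)^4 V(x) is a monic real polynomial of degree 8, where V is a monic real polynomial of degree 4 with no real roots, and U defines one of the sign patterns (+,+,−,−,−,+,−,+,+), (+,+,+,−,−,+,−,+,+), or (+,−,−,−,−,+,−,+,+). Then there exist a real number t ≥ 0 and real numbers S > 0, M, N with N ≥ M^2/4 such that U(x) − t(x−1)^4 = (x−1)^4 (x^2 + Sx + S^2/4)(x^2 + Mx + N) and the polynomial U(x) − t(x−1)^4 defines the same sign pattern as U. -/

import Mathlib

open Polynomial

/-- A degree-8 real polynomial `P` defines the sign pattern `σ = (σ_0, …, σ_8)`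
(with entries `1` for `+`, `-1` for `−`) if for each `j` the coefficient of
`x^(8-j)` is nonzero and has sign `σ_j`. -/
def definesSignPattern (P : Polynomial ℝ) (σ : Fin 9 → ℝ) : Prop :=
  ∀ j : Fin 9, Real.sign (P.coeff (8 - (j : ℕ))) = σ j

/-- The sign pattern of `(x-1)⁴ (x⁴ + ax³ + bx² + cx + d)` in terms of `a, b, c, d`. -/
theorem definesSignPattern_quartic_iff (a b c d : ℝ) (σ : Fin 9 → ℝ) :
    definesSignPattern
        ((X - 1) ^ 4 * (X ^ 4 + C a * X ^ 3 + C b * X ^ 2 + C c * X + C d)) σ ↔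
      Real.sign 1 = σ 0 ∧ Real.sign (a - 4) = σ 1 ∧ Real.sign (b - 4 * a + 6) = σ 2 ∧
      Real.sign (c - 4 * b + 6 * a - 4) = σ 3 ∧
      Real.sign (d - 4 * c + 6 * b - 4 * a + 1) = σ 4 ∧
      Real.sign (-4 * d + 6 * c - 4 * b + a) = σ 5 ∧
      Real.sign (6 * d - 4 * c + b) = σ 6 ∧ Real.sign (-4 * d + c) = σ 7 ∧
      Real.sign d = σ 8 := by
  have expand : (X - 1) ^ 4 * (X ^ 4 + C a * X ^ 3 + C b * X ^ 2 + C c * X + C d) =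
      C 1 * X ^ 8 + C (a - 4) * X ^ 7 + C (b - 4 * a + 6) * X ^ 6 +
      C (c - 4 * b + 6 * a - 4) * X ^ 5 + C (d - 4 * c + 6 * b - 4 * a + 1) * X ^ 4 +
      C (-4 * d + 6 * c - 4 * b + a) * X ^ 3 + C (6 * d - 4 * c + b) * X ^ 2 +
      C (-4 * d + c) * X ^ 1 + C d * X ^ 0 := by
    simp only [map_add, map_sub, map_mul, map_neg, map_one, map_ofNat]
    ring
  rw [expand]
  simp only [definesSignPattern, Fin.forall_fin_succ, coeff_add, coeff_C_mul, coeff_X_pow]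
  simp [Fin.succ]

theorem real_sign_eq_one_iff {x : ℝ} : Real.sign x = 1 ↔ 0 < x := by
  rcases lt_trichotomy x 0 with h | rfl | h
  · simp only [Real.sign_of_neg h, h.not_gt, iff_false]; norm_num
  · simp
  · simp [Real.sign_of_pos h, h]

theorem real_sign_eq_neg_one_iff {x : ℝ} : Real.sign x = -1 ↔ x < 0 := by
  rw [← neg_pos, ← real_sign_eq_one_iff, Real.sign_neg, neg_eq_iff_eq_neg]

/-- A real quartic with positive `x³` and `x` coefficients has no nonnegative minimizer. -/
theorem quartic_minimizer_neg {a b c d x₀ : ℝ} (ha : 0 < a) (hc : 0 < c)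
    (hderiv : 4 * x₀ ^ 3 + 3 * a * x₀ ^ 2 + 2 * b * x₀ + c = 0)
    (hmin : ∀ x, x₀ ^ 4 + a * x₀ ^ 3 + b * x₀ ^ 2 + c * x₀ + d ≤
      x ^ 4 + a * x ^ 3 + b * x ^ 2 + c * x + d) : x₀ < 0 := by
  by_contra! h
  rcases h.eq_or_lt with rfl | h
  · norm_num at hderiv
    exact hc.ne' hderiv
  · have := hmin (-x₀)
    have : 0 < a * x₀ ^ 3 := by positivity
    have : 0 < c * x₀ := by positivity
    nlinarith

/-- A monic real quadratic that is nonnegative away from one point has nonpositive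
discriminant. -/
theorem discrim_bound_of_nonneg_ne {x₀ M N : ℝ}
    (h : ∀ x, x ≠ x₀ → 0 ≤ x ^ 2 + M * x + N) : M ^ 2 / 4 ≤ N := by
  have hall : ∀ x, 0 ≤ x ^ 2 + M * x + N := by
    have hcl : IsClosed {x : ℝ | 0 ≤ x ^ 2 + M * x + N} :=
      isClosed_le (by fun_prop) (by fun_prop)
    have hd : Dense {x : ℝ | 0 ≤ x ^ 2 + M * x + N} :=
      (dense_compl_singleton x₀).mono fun x hx => h x hx
    intro x
    have : x ∈ closure {x : ℝ | 0 ≤ x ^ 2 + M * x + N} := hd x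
    rwa [hcl.closure_eq] at this
  nlinarith [hall (-M / 2)]

/-- A real polynomial of positive degree without roots, positive at one point, has a positive
global minimum. -/
theorem exists_pos_minimum {V : ℝ[X]} (hdeg : 0 < V.degree) (hroots : ∀ x, V.eval x ≠ 0)
    {y : ℝ} (hy : 0 < V.eval y) : ∃ x₀, 0 < V.eval x₀ ∧ ∀ x, V.eval x₀ ≤ V.eval x := by
  have hpos : ∀ x, 0 < V.eval x := by
    intro x
    by_contra! hx
    obtain ⟨z, hz⟩ := mem_range_of_exists_le_of_exists_ge V.continuous ⟨x, hx⟩ ⟨y, hy.le⟩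
    exact hroots z hz
  obtain ⟨x₀, hx₀⟩ := V.continuous.norm.exists_forall_le
    (V.tendsto_norm_atTop hdeg tendsto_norm_cocompact_atTop)
  refine ⟨x₀, hpos x₀, fun x => ?_⟩
  simpa only [Real.norm_of_nonneg (hpos _).le] using hx₀ x

theorem monic_quartic_eq {V : ℝ[X]} (hm : V.Monic) (hdeg : V.degree = 4) :
    V = X ^ 4 + C (V.coeff 3) * X ^ 3 + C (V.coeff 2) * X ^ 2 + C (V.coeff 1) * X +
      C (V.coeff 0) := by
  have hn : V.natDegree = 4 := natDegree_eq_of_degree_eq_some hdeg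
  have h4 : V.coeff 4 = 1 := hn ▸ hm
  conv_lhs => rw [V.as_sum_range_C_mul_X_pow, hn]
  simp only [Finset.sum_range_succ, Finset.sum_range_zero, h4, map_one]
  ring

theorem stmt12 (U V : Polynomial ℝ) (σ : Fin 9 → ℝ)
    (hVmonic : V.Monic) (hVdeg : V.degree = 4) (hVroots : ∀ x : ℝ, V.eval x ≠ 0)
    (hU : U = (X - 1) ^ 4 * V)
    (hσ : σ = ![1, 1, -1, -1, -1, 1, -1, 1, 1] ∨
          σ = ![1, 1, 1, -1, -1, 1, -1, 1, 1] ∨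
          σ = ![1, -1, -1, -1, -1, 1, -1, 1, 1])
    (hpat : definesSignPattern U σ) :
    ∃ t S M N : ℝ, 0 ≤ t ∧ 0 < S ∧ M ^ 2 / 4 ≤ N ∧
      U - C t * (X - 1) ^ 4 =
        (X - 1) ^ 4 * (X ^ 2 + C S * X + C (S ^ 2 / 4)) *
          (X ^ 2 + C M * X + C N) ∧
      definesSignPattern (U - C t * (X - 1) ^ 4) σ := by
  have hV := monic_quartic_eq hVmonic hVdeg
  generalize V.coeff 3 = a, V.coeff 2 = b, V.coeff 1 = c, V.coeff 0 = d at hV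
  have heval : ∀ x, V.eval x = x ^ 4 + a * x ^ 3 + b * x ^ 2 + c * x + d := by
    intro x; simp [hV]
  rw [hU, hV, definesSignPattern_quartic_iff] at hpat
  obtain ⟨h0, h1, h2, h3, h4, h5, h6, h7, h8⟩ := hpat
  have hσ3 : σ 3 = -1 := by rcases hσ with rfl | rfl | rfl <;> rfl
  have hσ4 : σ 4 = -1 := by rcases hσ with rfl | rfl | rfl <;> rfl
  have hσ5 : σ 5 = 1 := by rcases hσ with rfl | rfl | rfl <;> rfl
  have hσ6 : σ 6 = -1 := by rcases hσ with rfl | rfl | rfl <;> rfl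
  have hσ7 : σ 7 = 1 := by rcases hσ with rfl | rfl | rfl <;> rfl
  have hσ8 : σ 8 = 1 := by rcases hσ with rfl | rfl | rfl <;> rfl
  have h12 : σ 1 = 1 ∨ σ 2 = -1 := by
    rcases hσ with rfl | rfl | rfl
    exacts [Or.inl rfl, Or.inl rfl, Or.inr rfl]
  rw [← h1, ← h2, real_sign_eq_one_iff, real_sign_eq_neg_one_iff] at h12
  rw [hσ3, real_sign_eq_neg_one_iff] at h3
  rw [hσ4, real_sign_eq_neg_one_iff] at h4
  rw [hσ5, real_sign_eq_one_iff] at h5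
  rw [hσ6, real_sign_eq_neg_one_iff] at h6
  rw [hσ7, real_sign_eq_one_iff] at h7
  rw [hσ8, real_sign_eq_one_iff] at h8
  have hc : 0 < c := by linarith
  have ha : 0 < a := by rcases h12 with h | h <;> linarith
  obtain ⟨x₀, ht, hmin⟩ := exists_pos_minimum (by rw [hVdeg]; norm_num) hVroots
    (y := 0) (by simpa [heval] using h8)
  have hderiv : 4 * x₀ ^ 3 + 3 * a * x₀ ^ 2 + 2 * b * x₀ + c = 0 := by
    have hz : V.derivative.eval x₀ = 0 :=
      IsLocalMin.hasDerivAt_eq_zero (Filter.Eventually.of_forall hmin) (V.hasDerivAt x₀)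
    simp [hV] at hz
    linarith
  have hx₀ : x₀ < 0 := quartic_minimizer_neg ha hc hderiv (by simpa only [heval] using hmin)
  have hlt : V.eval x₀ < d := by
    refine lt_of_le_of_ne (by simpa [heval 0] using hmin 0) fun h => ?_
    refine (quartic_minimizer_neg (x₀ := 0) (b := b) (d := d) ha hc ?_ ?_).false
    · have hz : V.derivative.eval 0 = 0 :=
        IsLocalMin.hasDerivAt_eq_zero
          (Filter.Eventually.of_forall fun x => by simpa [heval 0, ← h] using hmin x)
          (V.hasDerivAt 0)
      simp [hV] at hz
      linarith
    · intro x
      simpa [← heval, h] using hmin x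
  have hfactor : ∀ x, V.eval x - V.eval x₀ =
      (x - x₀) ^ 2 * (x ^ 2 + (a + 2 * x₀) * x + (3 * x₀ ^ 2 + 2 * a * x₀ + b)) := by
    intro x
    rw [heval, heval]
    linear_combination (x - x₀) * hderiv
  have hsub : U - C (V.eval x₀) * (X - 1) ^ 4 = (X - 1) ^ 4 *
      (X ^ 4 + C a * X ^ 3 + C b * X ^ 2 + C c * X + C (d - V.eval x₀)) := by
    rw [hU, map_sub]
    conv_lhs => enter [1]; rw [hV]
    ring
  refine ⟨V.eval x₀, -2 * x₀, a + 2 * x₀, 3 * x₀ ^ 2 + 2 * a * x₀ + b, ht.le, by linarith,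
    discrim_bound_of_nonneg_ne (x₀ := x₀) fun x hx => ?_, ?_, ?_⟩
  · have hsq : 0 < (x - x₀) ^ 2 := by have := sub_ne_zero.2 hx; positivity
    exact nonneg_of_mul_nonneg_right (hfactor x ▸ sub_nonneg.2 (hmin x)) hsq
  · refine Polynomial.funext fun x => ?_
    have := hfactor x
    simp only [hU, eval_sub, eval_mul, eval_pow, eval_add, eval_X, eval_one, eval_C]
    linear_combination (x - 1) ^ 4 * this
  · rw [hsub, definesSignPattern_quartic_iff, hσ3, hσ4, hσ5, hσ6, hσ7, hσ8]
    simp only [real_sign_eq_one_iff, real_sign_eq_neg_one_iff]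
    refine ⟨h0, h1, h2, h3, ?_, ?_, ?_, ?_, ?_⟩ <;> linarith
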